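/- arXiv:1510.04729 — 3 statements merged into one kernel-verified Lean document; each statement's English description precedes it below -/
import Mathlib

section
/- Let d ∈ ℕ, C ≥ 0, and let h : ℝ^d → ℝ^d satisfy ‖h(x) − h(y)‖ ≤ C‖x − y‖ for all x, y ∈ ℝ^d. Let λ > 0, T > 0, M ∈ ℕ with M ≥ 1, p ∈ [1, ∞), z ∈ {−1, 1}, and let N be a random variable with Poisson distribution of parameter λT/M. For x ∈ ℝ^d define a(x) := 𝟙_{‖x‖ ≥ 1} · ⟨x, h(x)⟩ / ‖x‖² (with a(0) := 0). Then for every x ∈ ℝ^d, E[exp(p·z·a(x)·(N − λT/M))] ≤ exp( λT·(e^{p(C+‖h(0)‖)} + p(C + ‖h(0)‖)) / M ). -/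
open MeasureTheory ProbabilityTheory
open scoped RealInnerProductSpace

/-- Exponential moments of the compensated Poisson distribution. -/
theorem integral_exp_mul_sub_poissonMeasure (r : NNReal) (s : ℝ) :
    ∫ n : ℕ, Real.exp (s * ((n : ℝ) - r)) ∂(poissonMeasure r) =
      Real.exp (r * (Real.exp s - 1 - s)) := by
  rw [integral_poissonMeasure]
  have hsum : HasSum (fun n : ℕ => (r * Real.exp s) ^ n / (n.factorial : ℝ))
      (Real.exp (r * Real.exp s)) := by
    rw [Real.exp_eq_exp_ℝ]
    exact NormedSpace.expSeries_div_hasSum_exp _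
  have hterm : ∀ n : ℕ, (Real.exp (-r) * r ^ n / (n.factorial : ℝ)) •
      Real.exp (s * ((n : ℝ) - r)) =
      Real.exp (-r - s * r) * ((r * Real.exp s) ^ n / (n.factorial : ℝ)) := by
    intro n
    have hexp : Real.exp (s * ((n : ℝ) - r)) = Real.exp (-(s * r)) * Real.exp s ^ n := by
      rw [← Real.exp_nat_mul, ← Real.exp_add]
      ring_nf
    rw [hexp, sub_eq_add_neg (-(r : ℝ)), Real.exp_add, smul_eq_mul, mul_pow]
    ring
  simp_rw [hterm]
  rw [(hsum.mul_left _).tsum_eq, ← Real.exp_add]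
  ring_nf

/-- The radial component `⟪x, h x⟫ / ‖x‖ ^ 2` of a Lipschitz map is bounded outside the open unit
ball. -/
theorem abs_inner_div_norm_sq_le {E : Type*} [NormedAddCommGroup E] [InnerProductSpace ℝ E]
    {C : ℝ} {h : E → E} (hLip : ∀ x y, ‖h x - h y‖ ≤ C * ‖x - y‖) {x : E} (hx : 1 ≤ ‖x‖) :
    |⟪x, h x⟫ / ‖x‖ ^ 2| ≤ C + ‖h 0‖ := by
  have hpos : 0 < ‖x‖ := by linarith
  have hgrowth : ‖h x‖ ≤ (C + ‖h 0‖) * ‖x‖ := by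
    have h₁ : ‖h x - h 0‖ ≤ C * ‖x‖ := by simpa using hLip x 0
    have h₂ : ‖h x‖ ≤ ‖h x - h 0‖ + ‖h 0‖ := norm_le_norm_sub_add _ _
    nlinarith [norm_nonneg (h 0)]
  rw [abs_div, abs_of_pos (pow_pos hpos 2), div_le_iff₀ (pow_pos hpos 2)]
  calc |⟪x, h x⟫| ≤ ‖x‖ * ‖h x‖ := abs_real_inner_le_norm _ _
    _ ≤ ‖x‖ * ((C + ‖h 0‖) * ‖x‖) := by gcongr
    _ = (C + ‖h 0‖) * ‖x‖ ^ 2 := by ring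

/-- Paper's Lemma 4.6: exponential moment bound for the compensated Poisson increment tested
against the normalized jump coefficient. -/
theorem exp_moment_compensated_poisson_jump_coeff
    (d : ℕ) (C : ℝ) (hC : 0 ≤ C)
    (h : EuclideanSpace ℝ (Fin d) → EuclideanSpace ℝ (Fin d))
    (hLip : ∀ x y, ‖h x - h y‖ ≤ C * ‖x - y‖)
    (lam T : ℝ) (hlam : 0 < lam) (hT : 0 < T)
    (M : ℕ) (hM : 1 ≤ M)
    (p : ℝ) (hp : 1 ≤ p) (z : ℝ) (hz : z = -1 ∨ z = 1)
    {Ω : Type*} [MeasureSpace Ω] [IsProbabilityMeasure (ℙ : Measure Ω)]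
    (N : Ω → ℕ) (hNmeas : Measurable N)
    (hN : Measure.map N ℙ = poissonMeasure (lam * T / M).toNNReal)
    (a : EuclideanSpace ℝ (Fin d) → ℝ)
    (ha : ∀ x, a x = if 1 ≤ ‖x‖ then ⟪x, h x⟫ / ‖x‖ ^ 2 else 0) :
    ∀ x : EuclideanSpace ℝ (Fin d),
      (∫ ω, Real.exp (p * z * a x * ((N ω : ℝ) - lam * T / M)) ∂ℙ) ≤
        Real.exp (lam * T * (Real.exp (p * (C + ‖h 0‖)) + p * (C + ‖h 0‖)) / M) := by
  intro x
  have hθ : 0 ≤ lam * T / M := by positivity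
  have ha_le : |a x| ≤ C + ‖h 0‖ := by
    rw [ha]
    split_ifs with hx
    · exact abs_inner_div_norm_sq_le hLip hx
    · rw [abs_zero]
      positivity
  have hz_abs : |z| = 1 := by rcases hz with rfl | rfl <;> simp
  have hs : |p * z * a x| ≤ p * (C + ‖h 0‖) := by
    rw [abs_mul, abs_mul, hz_abs, mul_one, abs_of_nonneg (by linarith)]
    gcongr
  set s := p * z * a x
  have hint : ∫ ω, Real.exp (s * ((N ω : ℝ) - lam * T / M)) ∂ℙ =
      Real.exp (lam * T / M * (Real.exp s - 1 - s)) := by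
    have hmoment := integral_exp_mul_sub_poissonMeasure (lam * T / M).toNNReal s
    rw [← hN, Real.coe_toNNReal _ hθ,
      integral_map hNmeas.aemeasurable (by fun_prop)] at hmoment
    exact hmoment
  obtain ⟨hs_lower, hs_upper⟩ := abs_le.mp hs
  rw [hint, mul_div_right_comm (lam * T)]
  gcongr
  linarith [Real.exp_le_exp.mpr hs_upper]
end

section
/- With the tamed-Euler recursion and the quantities α_k, b_k, β, D_n defined in the context, the following holds for every n ∈ {0, 1, …, M}: if max_{0 ≤ k ≤ n−1} D_k ≤ M^{1/(2c)} and max_{0 ≤ k ≤ n−1}(‖w_k‖ ∨ |ν_k|) ≤ 1, then ‖Y_n‖ ≤ D_n. -/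
open scoped RealInnerProductSpace

theorem norm_le_of_lipschitz {E F : Type*} [NormedAddCommGroup E] [NormedAddCommGroup F]
    {g : E → F} {C : ℝ}
    (hg : ∀ x y, ‖g x - g y‖ ≤ C * ‖x - y‖) (y : E) : ‖g y‖ ≤ ‖g 0‖ + C * ‖y‖ := by
  have h := hg y 0
  rw [sub_zero] at h
  linarith [norm_sub_norm_le (g y) (g 0)]

theorem norm_le_of_polynomial_growth {E : Type*} [NormedAddCommGroup E] {f : E → E}
    {C K c : ℝ} (hc : 0 < c)
    (hf : ∀ x y, ‖f x - f y‖ ≤ C * (K + ‖x‖ ^ c + ‖y‖ ^ c) * ‖x - y‖) (y : E) :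
    ‖f y‖ ≤ ‖f 0‖ + C * (K + ‖y‖ ^ c) * ‖y‖ := by
  have h := hf y 0
  rw [sub_zero, norm_zero, Real.zero_rpow hc.ne', add_zero] at h
  linarith [norm_sub_norm_le (f y) (f 0)]

theorem le_mul_exp_of_sq_le {r s q : ℝ} (hs : 0 ≤ s) (h : r ^ 2 ≤ s ^ 2 * (1 + 2 * q)) :
    r ≤ s * Real.exp q := by
  refine le_of_sq_le_sq ?_ (by positivity)
  calc r ^ 2 ≤ s ^ 2 * (1 + 2 * q) := h
    _ ≤ s ^ 2 * Real.exp (2 * q) := by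
        gcongr
        linarith [Real.add_one_le_exp (2 * q)]
    _ = (s * Real.exp q) ^ 2 := by rw [mul_pow, ← Real.exp_nat_mul]; norm_num

/-- The constants hidden in the fourth power defining `β`. -/
theorem tamed_constants_le {C K T F G H : ℝ} (hC : 0 ≤ C) (hK : 0 ≤ K) (hT : 0 ≤ T)
    (hF : 0 ≤ F) (hG : 0 ≤ G) (hH : 0 ≤ H) {β : ℝ}
    (hβ : β = (1 + K + 2 * C + K * T * C + T * C + T + F + G + H) ^ 4) :
    1 + T * (F + C * K + C) + (G + C) + (H + C) ≤ β ∧ (G + C) ^ 2 ≤ β ∧ (H + C) ^ 2 ≤ β ∧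
      2 * (T * (C + F)) + 3 * (T * (F + C * K + C)) ^ 2 ≤ 3 * β := by
  obtain ⟨P, hP⟩ : ∃ P, P = K * T * C + T * C := ⟨_, rfl⟩
  have hPT : T * C ≤ P := hP ▸ le_add_of_nonneg_left (by positivity)
  have hP0 : 0 ≤ P := by rw [hP]; positivity
  have hTF : 0 ≤ T * F := by positivity
  obtain ⟨S, hS⟩ : ∃ S, S = 1 + K + 2 * C + P + T + F + G + H := ⟨_, rfl⟩
  have hβS : β = (S ^ 2) ^ 2 := by rw [hβ, hS, hP]; ring
  have hsplit : T * (F + C * K + C) = T * F + P := by rw [hP]; ring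
  clear hβ hP
  have hS1 : 1 + 2 * (C + P + G + H + T * F + C) ≤ S ^ 2 := by
    obtain ⟨R, hR⟩ : ∃ R, R = 2 * C + P + G + H := ⟨_, rfl⟩
    have hR0 : 0 ≤ R := by rw [hR]; positivity
    calc 1 + 2 * (C + P + G + H + T * F + C) = 1 + 2 * (R + T * F) := by rw [hR]; ring
      _ ≤ 1 + 2 * (R + T * F) + (T ^ 2 + F ^ 2 + R ^ 2 + 2 * T + 2 * F + 2 * T * R + 2 * F * R) :=
          le_add_of_nonneg_right (by positivity)
      _ = (1 + T + F + R) ^ 2 := by ring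
      _ ≤ S ^ 2 := by
          gcongr
          linarith
  have hS2 : S ^ 2 ≤ β := by
    rw [hβS]
    exact le_self_pow₀ (le_trans (le_add_of_nonneg_right (by positivity)) hS1) two_ne_zero
  refine ⟨?_, ?_, ?_, ?_⟩
  · linarith
  · rw [hβS]; gcongr; linarith
  · rw [hβS]; gcongr; linarith
  · have hsq : (2 * (T * F + P)) ^ 2 ≤ β := by rw [hβS]; gcongr; linarith
    rw [hsplit]
    linarith

/-- The tamed step size lies between `0` and the untamed step size `δ`. -/
theorem tamed_coeff_mem {δ r : ℝ} (hδ : 0 ≤ δ) (hr : 0 ≤ r) :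
    0 ≤ δ / (1 + δ * r) ∧ δ / (1 + δ * r) ≤ δ :=
  ⟨by positivity, div_le_self hδ (le_add_of_nonneg_right (by positivity))⟩

section TamedEulerStep

variable {E : Type*} [NormedAddCommGroup E] [InnerProductSpace ℝ E]

theorem norm_sq_add_add_add_le (y a p q : E) :
    ‖y + a + p + q‖ ^ 2 ≤ ‖y‖ ^ 2 + 2 * (⟪y, a⟫ + ⟪y, p⟫ + ⟪y, q⟫) +
      3 * (‖a‖ ^ 2 + ‖p‖ ^ 2 + ‖q‖ ^ 2) := by
  have hap := sq_nonneg ‖a - p‖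
  have haq := sq_nonneg ‖a - q‖
  have hpq := sq_nonneg ‖p - q‖
  rw [norm_sub_sq_real] at hap haq hpq
  rw [norm_add_sq_real, norm_add_sq_real, norm_add_sq_real]
  simp only [inner_add_left]
  linarith

theorem inner_self_le_of_one_sided {f : E → E} {C : ℝ}
    (hf : ∀ x y, ⟪x - y, f x - f y⟫ ≤ C * ‖x - y‖ ^ 2) (y : E) :
    ⟪y, f y⟫ ≤ C * ‖y‖ ^ 2 + ‖y‖ * ‖f 0‖ := by
  have h := hf y 0
  rw [sub_zero, inner_sub_right] at h
  linarith [real_inner_le_norm y (f 0)]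

variable {F : Type*} [NormedAddCommGroup F] [InnerProductSpace ℝ F]
  {f h : E → E} {g : E → F →L[ℝ] E} {C K c T N β : ℝ}

/-- Inside the unit ball a tamed Euler step stays below `β`. -/
theorem norm_tamed_step_le_of_norm_le_one (hC : 0 ≤ C) (hK : 0 ≤ K) (hc : 0 < c) (hT : 0 ≤ T)
    (hf : ∀ x y, ‖f x - f y‖ ≤ C * (K + ‖x‖ ^ c + ‖y‖ ^ c) * ‖x - y‖)
    (hg : ∀ x y, ‖g x - g y‖ ≤ C * ‖x - y‖) (hh : ∀ x y, ‖h x - h y‖ ≤ C * ‖x - y‖)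
    (hβ : β = (1 + K + 2 * C + K * T * C + T * C + T + ‖f 0‖ + ‖g 0‖ + ‖h 0‖) ^ 4)
    {y : E} {w : F} {ν τ : ℝ} (hy : ‖y‖ ≤ 1) (hw : ‖w‖ ≤ 1) (hν : |ν| ≤ 1)
    (hτ0 : 0 ≤ τ) (hτ : τ ≤ T) :
    ‖y + τ • f y + g y w + ν • h y‖ ≤ β := by
  have hyc : ‖y‖ ^ c ≤ 1 := Real.rpow_le_one (norm_nonneg y) hy hc.le
  have hfy : ‖f y‖ ≤ ‖f 0‖ + C * K + C := by
    have : C * (K + ‖y‖ ^ c) * ‖y‖ ≤ C * (K + 1) * 1 := by gcongr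
    linarith [norm_le_of_polynomial_growth hc hf y]
  have hgy : ‖g y‖ ≤ ‖g 0‖ + C := by
    linarith [norm_le_of_lipschitz hg y, mul_le_of_le_one_right hC hy]
  have hhy : ‖h y‖ ≤ ‖h 0‖ + C := by
    linarith [norm_le_of_lipschitz hh y, mul_le_of_le_one_right hC hy]
  have hdrift : ‖τ • f y‖ ≤ T * (‖f 0‖ + C * K + C) := by
    rw [norm_smul, Real.norm_of_nonneg hτ0]
    gcongr
  have hnoise : ‖g y w‖ ≤ ‖g 0‖ + C := by
    calc ‖g y w‖ ≤ ‖g y‖ * ‖w‖ := (g y).le_opNorm w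
      _ ≤ (‖g 0‖ + C) * 1 := by gcongr
      _ = ‖g 0‖ + C := mul_one _
  have hjump : ‖ν • h y‖ ≤ ‖h 0‖ + C := by
    calc ‖ν • h y‖ = |ν| * ‖h y‖ := by rw [norm_smul, Real.norm_eq_abs]
      _ ≤ 1 * (‖h 0‖ + C) := by gcongr
      _ = ‖h 0‖ + C := one_mul _
  obtain ⟨hconst, -⟩ := tamed_constants_le hC hK hT (norm_nonneg (f 0)) (norm_nonneg (g 0))
    (norm_nonneg (h 0)) hβ
  calc ‖y + τ • f y + g y w + ν • h y‖ ≤ ‖y‖ + ‖τ • f y‖ + ‖g y w‖ + ‖ν • h y‖ := norm_add₄_le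
    _ ≤ β := by linarith

/-- Outside the unit ball, but below `N ^ (1 / (2 * c))`, a tamed Euler step grows the norm by at
most an exponential factor. -/
theorem norm_tamed_step_le_mul_exp (hC : 0 ≤ C) (hK : 0 ≤ K) (hc : 0 < c) (hT : 0 ≤ T)
    (hN : 1 ≤ N) (hf_inner : ∀ x y, ⟪x - y, f x - f y⟫ ≤ C * ‖x - y‖ ^ 2)
    (hf : ∀ x y, ‖f x - f y‖ ≤ C * (K + ‖x‖ ^ c + ‖y‖ ^ c) * ‖x - y‖)
    (hg : ∀ x y, ‖g x - g y‖ ≤ C * ‖x - y‖) (hh : ∀ x y, ‖h x - h y‖ ≤ C * ‖x - y‖)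
    (hβ : β = (1 + K + 2 * C + K * T * C + T * C + T + ‖f 0‖ + ‖g 0‖ + ‖h 0‖) ^ 4)
    {y : E} {w : F} {ν τ : ℝ} (hy : 1 ≤ ‖y‖) (hyN : ‖y‖ ≤ N ^ (1 / (2 * c))) (hν : |ν| ≤ 1)
    (hτ0 : 0 ≤ τ) (hτ : τ ≤ T / N) :
    ‖y + τ • f y + g y w + ν • h y‖ ≤ ‖y‖ * Real.exp (3 * β / 2 / N +
      (3 * β / 2 * ‖w‖ ^ 2 + 3 * β / 2 * |ν| + ⟪y, g y w⟫ / ‖y‖ ^ 2 +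
        ⟪y, ν • h y⟫ / ‖y‖ ^ 2)) := by
  have hN0 : 0 < N := by linarith
  have hy0 : 0 < ‖y‖ := by linarith
  obtain ⟨-, hGβ, hHβ, hFβ⟩ := tamed_constants_le hC hK hT (norm_nonneg (f 0))
    (norm_nonneg (g 0)) (norm_nonneg (h 0)) hβ
  have hyc : ‖y‖ ^ c ≤ √N := by
    calc ‖y‖ ^ c ≤ (N ^ (1 / (2 * c))) ^ c := by gcongr
      _ = √N := by
        rw [← Real.rpow_mul hN0.le, Real.sqrt_eq_rpow]
        congr 1
        field_simp
  have hsqrt : 1 ≤ √N := Real.one_le_sqrt.mpr hN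
  have hsq : √N ^ 2 = N := Real.sq_sqrt hN0.le
  have hfy : ‖f y‖ ≤ √N * (‖f 0‖ + C * K + C) * ‖y‖ := by
    calc ‖f y‖ ≤ ‖f 0‖ * 1 * 1 + C * (K * 1 + ‖y‖ ^ c) * ‖y‖ := by
          simpa using norm_le_of_polynomial_growth hc hf y
      _ ≤ ‖f 0‖ * √N * ‖y‖ + C * (K * √N + √N) * ‖y‖ := by gcongr
      _ = √N * (‖f 0‖ + C * K + C) * ‖y‖ := by ring
  have hdrift : ‖τ • f y‖ ^ 2 ≤ (T * (‖f 0‖ + C * K + C)) ^ 2 / N * ‖y‖ ^ 2 := by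
    rw [norm_smul, Real.norm_of_nonneg hτ0]
    calc (τ * ‖f y‖) ^ 2 ≤ (T / N * (√N * (‖f 0‖ + C * K + C) * ‖y‖)) ^ 2 := by gcongr
      _ = √N ^ 2 * (T * (‖f 0‖ + C * K + C)) ^ 2 / N ^ 2 * ‖y‖ ^ 2 := by ring
      _ = (T * (‖f 0‖ + C * K + C)) ^ 2 / N * ‖y‖ ^ 2 := by rw [hsq]; field_simp
  have hinner : ⟪y, τ • f y⟫ ≤ T * (C + ‖f 0‖) / N * ‖y‖ ^ 2 := by
    rw [real_inner_smul_right]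
    calc τ * ⟪y, f y⟫ ≤ τ * ((C + ‖f 0‖) * ‖y‖ ^ 2) := by
          gcongr
          linarith [inner_self_le_of_one_sided hf_inner y,
            le_mul_of_one_le_right (mul_nonneg hy0.le (norm_nonneg (f 0))) hy]
      _ ≤ T / N * ((C + ‖f 0‖) * ‖y‖ ^ 2) := by gcongr
      _ = T * (C + ‖f 0‖) / N * ‖y‖ ^ 2 := by ring
  have hgy : ‖g y‖ ≤ (‖g 0‖ + C) * ‖y‖ := by
    linarith [norm_le_of_lipschitz hg y, le_mul_of_one_le_right (norm_nonneg (g 0)) hy]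
  have hhy : ‖h y‖ ≤ (‖h 0‖ + C) * ‖y‖ := by
    linarith [norm_le_of_lipschitz hh y, le_mul_of_one_le_right (norm_nonneg (h 0)) hy]
  have hnoise : ‖g y w‖ ^ 2 ≤ β * ‖w‖ ^ 2 * ‖y‖ ^ 2 := by
    calc ‖g y w‖ ^ 2 ≤ ((‖g 0‖ + C) * ‖y‖ * ‖w‖) ^ 2 := by
          gcongr
          exact ((g y).le_opNorm w).trans (by gcongr)
      _ = (‖g 0‖ + C) ^ 2 * ‖w‖ ^ 2 * ‖y‖ ^ 2 := by ring
      _ ≤ β * ‖w‖ ^ 2 * ‖y‖ ^ 2 := by gcongr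
  have hjump : ‖ν • h y‖ ^ 2 ≤ β * |ν| * ‖y‖ ^ 2 := by
    have hβ0 : 0 ≤ β := (sq_nonneg _).trans hHβ
    calc ‖ν • h y‖ ^ 2 = (|ν| * ‖h y‖) ^ 2 := by rw [norm_smul, Real.norm_eq_abs]
      _ ≤ (|ν| * ((‖h 0‖ + C) * ‖y‖)) ^ 2 := by gcongr
      _ = |ν| * (‖h 0‖ + C) ^ 2 * |ν| * ‖y‖ ^ 2 := by ring
      _ ≤ 1 * β * |ν| * ‖y‖ ^ 2 := by gcongr
      _ = β * |ν| * ‖y‖ ^ 2 := by rw [one_mul]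
  have hconst : 2 * (T * (C + ‖f 0‖) / N * ‖y‖ ^ 2) +
      3 * ((T * (‖f 0‖ + C * K + C)) ^ 2 / N * ‖y‖ ^ 2) ≤ 3 * β / N * ‖y‖ ^ 2 := by
    calc _ = (2 * (T * (C + ‖f 0‖)) + 3 * (T * (‖f 0‖ + C * K + C)) ^ 2) / N * ‖y‖ ^ 2 := by ring
      _ ≤ 3 * β / N * ‖y‖ ^ 2 := by gcongr
  apply le_mul_exp_of_sq_le hy0.le
  have hα : ‖y‖ ^ 2 * (⟪y, g y w⟫ / ‖y‖ ^ 2) = ⟪y, g y w⟫ := by field_simp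
  have hb : ‖y‖ ^ 2 * (⟪y, ν • h y⟫ / ‖y‖ ^ 2) = ⟪y, ν • h y⟫ := by field_simp
  calc _ ≤ _ := norm_sq_add_add_add_le y (τ • f y) (g y w) (ν • h y)
    _ ≤ ‖y‖ ^ 2 + 3 * β / N * ‖y‖ ^ 2 + 3 * (β * ‖w‖ ^ 2 * ‖y‖ ^ 2) + 3 * (β * |ν| * ‖y‖ ^ 2) +
        2 * (‖y‖ ^ 2 * (⟪y, g y w⟫ / ‖y‖ ^ 2)) + 2 * (‖y‖ ^ 2 * (⟪y, ν • h y⟫ / ‖y‖ ^ 2)) := by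
        rw [hα, hb]
        linarith
    _ = _ := by ring

end TamedEulerStep

/-- Pathwise form of the paper's Lemma 4.2: on the event where the dominating process `D`
stays below `M^(1/(2c))` and the increments stay below `1`, the tamed Euler iterates `Y`
are dominated by `D`. -/
theorem tamed_euler_dominated_by_D
    (d m M : ℕ) (hM : 1 ≤ M) (T : ℝ) (hT : 0 < T)
    (C K c : ℝ) (hC : 0 ≤ C) (hK : 0 ≤ K) (hc : 0 < c)
    (Δt : ℝ) (hΔt : Δt = T / M)
    (fl : EuclideanSpace ℝ (Fin d) → EuclideanSpace ℝ (Fin d))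
    (g : EuclideanSpace ℝ (Fin d) → (EuclideanSpace ℝ (Fin m) →L[ℝ] EuclideanSpace ℝ (Fin d)))
    (h : EuclideanSpace ℝ (Fin d) → EuclideanSpace ℝ (Fin d))
    (hfl_onesided : ∀ x y, ⟪x - y, fl x - fl y⟫ ≤ C * ‖x - y‖ ^ 2)
    (hfl_poly : ∀ x y, ‖fl x - fl y‖ ≤ C * (K + ‖x‖ ^ c + ‖y‖ ^ c) * ‖x - y‖)
    (hg : ∀ x y, ‖g x - g y‖ ≤ C * ‖x - y‖)
    (hh : ∀ x y, ‖h x - h y‖ ≤ C * ‖x - y‖)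
    (w : ℕ → EuclideanSpace ℝ (Fin m)) (ν : ℕ → ℝ)
    (x₀ : EuclideanSpace ℝ (Fin d))
    (Y : ℕ → EuclideanSpace ℝ (Fin d))
    (hY0 : Y 0 = x₀)
    (hYrec : ∀ n < M, Y (n + 1) =
      Y n + (Δt / (1 + Δt * ‖fl (Y n)‖)) • fl (Y n) + g (Y n) (w n) + ν n • h (Y n))
    (α b : ℕ → ℝ)
    (hα : ∀ k, α k = if 1 ≤ ‖Y k‖ then ⟪Y k, g (Y k) (w k)⟫ / ‖Y k‖ ^ 2 else 0)
    (hb : ∀ k, b k = if 1 ≤ ‖Y k‖ then ⟪Y k, ν k • h (Y k)⟫ / ‖Y k‖ ^ 2 else 0)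
    (β : ℝ)
    (hβ : β = (1 + K + 2 * C + K * T * C + T * C + T + ‖fl 0‖ + ‖g 0‖ + ‖h 0‖) ^ 4)
    (D : ℕ → ℝ)
    (hD : ∀ n, D n = (β + ‖x₀‖) * Real.exp (3 * β / 2 +
      (Finset.range (n + 1)).sup' (Finset.nonempty_range_iff.mpr n.succ_ne_zero) (fun u =>
        ∑ k ∈ Finset.Ico u n,
          (3 * β / 2 * ‖w k‖ ^ 2 + 3 * β / 2 * |ν k| + α k + b k))))
    (n : ℕ) (hn : n ≤ M)
    (hDsmall : ∀ k < n, D k ≤ (M : ℝ) ^ (1 / (2 * c)))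
    (hincr : ∀ k < n, ‖w k‖ ≤ 1 ∧ |ν k| ≤ 1) :
    ‖Y n‖ ≤ D n := by
  have hM1 : (1 : ℝ) ≤ M := by exact_mod_cast hM
  have hM0 : (0 : ℝ) < M := by linarith
  have hδ0 : 0 ≤ Δt := by rw [hΔt]; positivity
  have hβ0 : 0 ≤ β := by rw [hβ]; positivity
  set s : ℕ → ℝ := fun k => 3 * β / 2 * ‖w k‖ ^ 2 + 3 * β / 2 * |ν k| + α k + b k with hs
  have le_D (n u : ℕ) (hnM : n ≤ M) (hu : u ≤ n)
      (hY : ‖Y n‖ ≤ (β + ‖x₀‖) *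
        Real.exp (3 * β / 2 / M * n + ∑ k ∈ Finset.Ico u n, s k)) : ‖Y n‖ ≤ D n := by
    rw [hD]
    refine hY.trans ?_
    gcongr
    · calc 3 * β / 2 / M * n ≤ 3 * β / 2 / M * M := by gcongr
        _ = 3 * β / 2 := by field_simp
    · exact Finset.le_sup' (fun u => ∑ k ∈ Finset.Ico u n, s k)
        (Finset.mem_range.mpr (Nat.lt_succ_of_le hu))
  suffices H : ∃ u ≤ n, ‖Y n‖ ≤ (β + ‖x₀‖) *
      Real.exp (3 * β / 2 / M * n + ∑ k ∈ Finset.Ico u n, s k) by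
    obtain ⟨u, hu, hY⟩ := H
    exact le_D n u hn hu hY
  induction n with
  | zero => exact ⟨0, le_rfl, by simp [hY0, hβ0]⟩
  | succ n ih =>
    have hnM : n < M := hn
    obtain ⟨u, hu, hY⟩ := ih hnM.le (fun k hk => hDsmall k (by lia))
      (fun k hk => hincr k (by lia))
    obtain ⟨hw, hν⟩ := hincr n n.lt_succ_self
    obtain ⟨hτ0, hτ⟩ := tamed_coeff_mem hδ0 (norm_nonneg (fl (Y n)))
    rw [hYrec n hnM]
    rcases lt_or_ge ‖Y n‖ 1 with hlt | hge
    · refine ⟨n + 1, le_rfl, ?_⟩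
      have hτT : Δt / (1 + Δt * ‖fl (Y n)‖) ≤ T :=
        hτ.trans (hΔt.trans_le (div_le_self hT.le hM1))
      calc _ ≤ β := norm_tamed_step_le_of_norm_le_one hC hK hc hT.le hfl_poly hg hh hβ hlt.le
            hw hν hτ0 hτT
        _ ≤ (β + ‖x₀‖) * 1 := by simp
        _ ≤ _ := by
          gcongr
          rw [Finset.Ico_self, Finset.sum_empty, Real.one_le_exp_iff]
          positivity
    · refine ⟨u, hu.trans n.le_succ, ?_⟩
      have hYM := (le_D n u hnM.le hu hY).trans (hDsmall n n.lt_succ_self)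
      have hsn : s n = 3 * β / 2 * ‖w n‖ ^ 2 + 3 * β / 2 * |ν n| +
          ⟪Y n, g (Y n) (w n)⟫ / ‖Y n‖ ^ 2 + ⟪Y n, ν n • h (Y n)⟫ / ‖Y n‖ ^ 2 := by
        simp only [hs, hα, hb, if_pos hge]
      calc _ ≤ ‖Y n‖ * Real.exp (3 * β / 2 / M + s n) := by
            rw [hsn]
            exact norm_tamed_step_le_mul_exp hC hK hc hT.le hM1 hfl_onesided hfl_poly hg hh hβ
              hge hYM hν hτ0 (hτ.trans_eq hΔt)
        _ ≤ (β + ‖x₀‖) * Real.exp (3 * β / 2 / M * n + ∑ k ∈ Finset.Ico u n, s k) *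
            Real.exp (3 * β / 2 / M + s n) := by gcongr
        _ = _ := by
          rw [mul_assoc, ← Real.exp_add, Finset.sum_Ico_succ_top hu]
          push_cast
          ring_nf
end

section
/- Let M ∈ ℕ with M ≥ 1 and Δt := T/M. Let x ∈ ℝ^d with 1 ≤ ‖x‖ ≤ M^{1/(2c)}, w ∈ ℝ^m, and ν ∈ ℝ with |ν| ≤ 1. Set Y⁺ := x + Δt·f_λ(x)/(1 + Δt‖f_λ(x)‖) + g(x)w + h(x)ν, α := ⟨x, g(x)w⟩/‖x‖², and b := ⟨x, h(x)ν⟩/‖x‖². Then ‖Y⁺‖² ≤ ‖x‖² · exp( 3β/M + 3β‖w‖² + 3β|ν| + 2α + 2b ). -/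
open scoped RealInnerProductSpace

/-- The squared norm of a sum of four vectors, where only the last three pairwise inner products
are estimated by Young's inequality. -/
theorem norm_add_four_sq_le {E : Type*} [NormedAddCommGroup E] [InnerProductSpace ℝ E]
    (x u v z : E) :
    ‖x + u + v + z‖ ^ 2 ≤
      ‖x‖ ^ 2 + 2 * ⟪x, u⟫ + 2 * ⟪x, v⟫ + 2 * ⟪x, z⟫
        + 3 * ‖u‖ ^ 2 + 3 * ‖v‖ ^ 2 + 3 * ‖z‖ ^ 2 := by
  have h1 := norm_sub_sq_real u v
  have h2 := norm_sub_sq_real u z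
  have h3 := norm_sub_sq_real v z
  have e1 := norm_add_sq_real (x + u + v) z
  have e2 := norm_add_sq_real (x + u) v
  have e3 := norm_add_sq_real x u
  simp only [inner_add_left] at e1 e2
  linarith [sq_nonneg ‖u - v‖, sq_nonneg ‖u - z‖, sq_nonneg ‖v - z‖]

/-- A globally Lipschitz map grows at most linearly outside the unit ball. -/
theorem norm_le_mul_norm_of_lipschitz {E F : Type*} [NormedAddCommGroup E] [NormedAddCommGroup F]
    {φ : E → F} {C : ℝ} (hφ : ∀ x y, ‖φ x - φ y‖ ≤ C * ‖x - y‖) {x : E} (hx : 1 ≤ ‖x‖) :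
    ‖φ x‖ ≤ (‖φ 0‖ + C) * ‖x‖ := by
  have h1 := hφ x 0
  rw [sub_zero] at h1
  have h2 := norm_le_norm_add_norm_sub' (φ x) (φ 0)
  nlinarith [norm_nonneg (φ 0)]

/-- A one-sided Lipschitz map satisfies a quadratic coercivity bound outside the unit ball. -/
theorem inner_self_le_of_one_sided_lipschitz {E : Type*} [NormedAddCommGroup E]
    [InnerProductSpace ℝ E] {φ : E → E} {C : ℝ}
    (hφ : ∀ x y, ⟪x - y, φ x - φ y⟫ ≤ C * ‖x - y‖ ^ 2) {x : E} (hx : 1 ≤ ‖x‖) :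
    ⟪x, φ x⟫ ≤ (‖φ 0‖ + C) * ‖x‖ ^ 2 := by
  have h1 := hφ x 0
  rw [sub_zero, inner_sub_right] at h1
  have h2 := real_inner_le_norm x (φ 0)
  have h3 : ‖x‖ * ‖φ 0‖ ≤ ‖x‖ ^ 2 * ‖φ 0‖ := by
    gcongr
    nlinarith
  linarith

/-- Growth of a locally Lipschitz map with polynomially growing constant, for arguments of norm at
least one and at most `N ^ (1 / (2 * c))`. -/
theorem norm_sq_le_of_polynomial_growth {E F : Type*} [NormedAddCommGroup E]
    [NormedAddCommGroup F] {φ : E → F} {C K c N : ℝ} (hC : 0 ≤ C) (hK : 0 ≤ K) (hc : 0 < c)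
    (hN : 0 ≤ N) (hφ : ∀ x y, ‖φ x - φ y‖ ≤ C * (K + ‖x‖ ^ c + ‖y‖ ^ c) * ‖x - y‖)
    {x : E} (hx : 1 ≤ ‖x‖) (hxN : ‖x‖ ≤ N ^ (1 / (2 * c))) :
    ‖φ x‖ ^ 2 ≤ N * ((‖φ 0‖ + C * K + C) * ‖x‖) ^ 2 := by
  have hp1 : 1 ≤ ‖x‖ ^ c := Real.one_le_rpow hx hc.le
  have hpN : (‖x‖ ^ c) ^ 2 ≤ N := by
    have h1 : ‖x‖ ^ c ≤ N ^ (1 / 2 : ℝ) := by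
      calc ‖x‖ ^ c ≤ (N ^ (1 / (2 * c))) ^ c := by gcongr
        _ = N ^ (1 / 2 : ℝ) := by
          rw [← Real.rpow_mul hN]
          congr 1
          field_simp
    rw [← Real.sqrt_eq_rpow] at h1
    calc (‖x‖ ^ c) ^ 2 ≤ √N ^ 2 := by gcongr
      _ = N := Real.sq_sqrt hN
  have h1 : ‖φ x - φ 0‖ ≤ C * (K + ‖x‖ ^ c) * ‖x‖ := by
    simpa [Real.zero_rpow hc.ne'] using hφ x 0
  generalize ‖x‖ ^ c = p at *
  have h2 := norm_le_norm_add_norm_sub' (φ x) (φ 0)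
  have h3 : ‖φ x‖ ≤ p * ((‖φ 0‖ + C * K + C) * ‖x‖) := by
    have h4 : ‖φ 0‖ ≤ p * ‖x‖ * ‖φ 0‖ :=
      le_mul_of_one_le_left (norm_nonneg _) (one_le_mul_of_one_le_of_one_le hp1 hx)
    have h5 : C * K * ‖x‖ ≤ p * (C * K * ‖x‖) := le_mul_of_one_le_left (by positivity) hp1
    linarith
  calc ‖φ x‖ ^ 2 ≤ (p * ((‖φ 0‖ + C * K + C) * ‖x‖)) ^ 2 := by gcongr
    _ = p ^ 2 * ((‖φ 0‖ + C * K + C) * ‖x‖) ^ 2 := by ring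
    _ ≤ N * ((‖φ 0‖ + C * K + C) * ‖x‖) ^ 2 := by gcongr

/-- One-step exponential bound (4.13) in the proof of the paper's Lemma 4.2: on the event
`1 ≤ ‖x‖ ≤ M^(1/(2c))` and `|ν| ≤ 1`, the squared norm after one compensated tamed Euler
step is dominated by `‖x‖²` times an exponential factor. -/
theorem tamed_euler_one_step_exp_bound
    (d m M : ℕ) (hM : 1 ≤ M) (T C K c : ℝ) (hT : 0 < T) (hC : 0 ≤ C) (hK : 0 ≤ K) (hc : 0 < c)
    (Δt : ℝ) (hΔt : Δt = T / M)
    (fl : EuclideanSpace ℝ (Fin d) → EuclideanSpace ℝ (Fin d))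
    (g : EuclideanSpace ℝ (Fin d) → (EuclideanSpace ℝ (Fin m) →L[ℝ] EuclideanSpace ℝ (Fin d)))
    (h : EuclideanSpace ℝ (Fin d) → EuclideanSpace ℝ (Fin d))
    (hfl_onesided : ∀ x y, ⟪x - y, fl x - fl y⟫ ≤ C * ‖x - y‖ ^ 2)
    (hfl_poly : ∀ x y, ‖fl x - fl y‖ ≤ C * (K + ‖x‖ ^ c + ‖y‖ ^ c) * ‖x - y‖)
    (hg : ∀ x y, ‖g x - g y‖ ≤ C * ‖x - y‖)
    (hh : ∀ x y, ‖h x - h y‖ ≤ C * ‖x - y‖)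
    (β : ℝ)
    (hβ : β = (1 + K + 2 * C + K * T * C + T * C + T + ‖fl 0‖ + ‖g 0‖ + ‖h 0‖) ^ 4)
    (x : EuclideanSpace ℝ (Fin d)) (hx1 : 1 ≤ ‖x‖) (hx2 : ‖x‖ ≤ (M : ℝ) ^ (1 / (2 * c)))
    (w : EuclideanSpace ℝ (Fin m)) (ν : ℝ) (hν : |ν| ≤ 1)
    (Yplus : EuclideanSpace ℝ (Fin d))
    (hYplus : Yplus = x + (Δt / (1 + Δt * ‖fl x‖)) • fl x + g x w + ν • h x)
    (α b : ℝ)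
    (hα : α = ⟪x, g x w⟫ / ‖x‖ ^ 2) (hb : b = ⟪x, ν • h x⟫ / ‖x‖ ^ 2) :
    ‖Yplus‖ ^ 2 ≤ ‖x‖ ^ 2 *
      Real.exp (3 * β / M + 3 * β * ‖w‖ ^ 2 + 3 * β * |ν| + 2 * α + 2 * b) := by
  have hM0 : (0 : ℝ) < M := by exact_mod_cast hM
  have hx0 : 0 < ‖x‖ := by linarith
  have hf2 := norm_sq_le_of_polynomial_growth hC hK hc hM0.le hfl_poly hx1 hx2
  have hfi := inner_self_le_of_one_sided_lipschitz hfl_onesided hx1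
  have hgn := norm_le_mul_norm_of_lipschitz hg hx1
  have hhn := norm_le_mul_norm_of_lipschitz hh hx1
  have hmain := norm_add_four_sq_le x ((Δt / (1 + Δt * ‖fl x‖)) • fl x) (g x w) (ν • h x)
  rw [← hYplus, real_inner_smul_right, norm_smul (Δt / _), mul_pow,
    Real.norm_eq_abs, sq_abs] at hmain
  have hΔ0 : 0 ≤ Δt := hΔt ▸ by positivity
  have hs0 : 0 ≤ Δt / (1 + Δt * ‖fl x‖) := by positivity
  have hsT : Δt / (1 + Δt * ‖fl x‖) ≤ T / M := by
    rw [← hΔt]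
    exact div_le_self hΔ0 (le_add_of_nonneg_right (by positivity))
  generalize Δt / (1 + Δt * ‖fl x‖) = s at *
  set B := 1 + K + 2 * C + K * T * C + T * C + T + ‖fl 0‖ + ‖g 0‖ + ‖h 0‖ with hB
  have ha := norm_nonneg (fl 0)
  have hG := norm_nonneg (g 0)
  have hH := norm_nonneg (h 0)
  have hKTC : 0 ≤ K * T * C := by positivity
  have hTC : 0 ≤ T * C := by positivity
  have hB1 : 1 ≤ B := by linarith
  have hβ2 : β = (B ^ 2) ^ 2 := by rw [hβ]; ring
  have hBB : B ^ 2 ≤ β := hβ2 ▸ le_self_pow₀ (one_le_pow₀ hB1) two_ne_zero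
  have hβ0 : 0 ≤ β := (sq_nonneg B).trans hBB
  have hdrift : 2 * (s * ⟪x, fl x⟫) + 3 * (s ^ 2 * ‖fl x‖ ^ 2) ≤ 3 * β / M * ‖x‖ ^ 2 := by
    have h1 : s * ⟪x, fl x⟫ ≤ T / M * ((‖fl 0‖ + C) * ‖x‖ ^ 2) :=
      (mul_le_mul_of_nonneg_left hfi hs0).trans (by gcongr)
    have h2 : s ^ 2 * ‖fl x‖ ^ 2 ≤
        (T / M) ^ 2 * (M * ((‖fl 0‖ + C * K + C) * ‖x‖) ^ 2) := by gcongr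
    have hu : 2 * (T * (‖fl 0‖ + C * K + C)) ≤ B ^ 2 := by
      have hsum : (1 + ‖fl 0‖ + T + K * T * C + T * C) ^ 2 ≤ B ^ 2 := by
        gcongr
        linarith
      have hexp : 0 ≤ (1 + ‖fl 0‖ + T + K * T * C + T * C) ^ 2 -
          2 * (T * (‖fl 0‖ + C * K + C)) := by
        calc (0 : ℝ) ≤ 1 + 2 * ‖fl 0‖ + 2 * T + ‖fl 0‖ ^ 2 + T ^ 2 +
              (K * T * C + T * C) ^ 2 + 2 * (‖fl 0‖ + T) * (K * T * C + T * C) := by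
              positivity
          _ = _ := by ring
      linarith
    have hcoef : 2 * (T * (‖fl 0‖ + C)) + 3 * (T * (‖fl 0‖ + C * K + C)) ^ 2 ≤ 3 * β := by
      have hu2 : (2 * (T * (‖fl 0‖ + C * K + C))) ^ 2 ≤ (B ^ 2) ^ 2 := by gcongr
      rw [← hβ2] at hu2
      linarith
    calc _ ≤ 2 * (T / M * ((‖fl 0‖ + C) * ‖x‖ ^ 2)) +
          3 * ((T / M) ^ 2 * (M * ((‖fl 0‖ + C * K + C) * ‖x‖) ^ 2)) := by linarith
      _ = (2 * (T * (‖fl 0‖ + C)) + 3 * (T * (‖fl 0‖ + C * K + C)) ^ 2) / M * ‖x‖ ^ 2 := by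
          field_simp
      _ ≤ _ := by gcongr
  have hdiff : ‖g x w‖ ^ 2 ≤ β * ‖w‖ ^ 2 * ‖x‖ ^ 2 := by
    calc ‖g x w‖ ^ 2 ≤ (B * ‖x‖ * ‖w‖) ^ 2 := by
          gcongr
          refine (g x).le_of_opNorm_le (hgn.trans ?_) w
          gcongr
          linarith
      _ = B ^ 2 * ‖w‖ ^ 2 * ‖x‖ ^ 2 := by ring
      _ ≤ _ := by gcongr
  have hjump : ‖ν • h x‖ ^ 2 ≤ β * |ν| * ‖x‖ ^ 2 := by
    calc ‖ν • h x‖ ^ 2 ≤ (|ν| * (B * ‖x‖)) ^ 2 := by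
          rw [norm_smul, Real.norm_eq_abs]
          gcongr
          refine hhn.trans ?_
          gcongr
          linarith
      _ = B ^ 2 * |ν| ^ 2 * ‖x‖ ^ 2 := by ring
      _ ≤ _ := by
          gcongr
          exact pow_le_of_le_one (abs_nonneg ν) hν two_ne_zero
  have hα' : ⟪x, g x w⟫ = α * ‖x‖ ^ 2 := by rw [hα]; field_simp
  have hb' : ⟪x, ν • h x⟫ = b * ‖x‖ ^ 2 := by rw [hb]; field_simp
  rw [hα', hb'] at hmain
  calc ‖Yplus‖ ^ 2 ≤ ‖x‖ ^ 2 *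
        (3 * β / M + 3 * β * ‖w‖ ^ 2 + 3 * β * |ν| + 2 * α + 2 * b + 1) := by linarith
    _ ≤ _ := by
        gcongr
        exact Real.add_one_le_exp _
end
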